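/- Let F' = k(t, y) be the function field of the curve y^(q+1) = t^q − 2·t^((q+1)/2) + t, and let η ∈ k satisfy η^q = η and η^((q−1)/2) = −1. Then F' is a finite Galois extension of the intermediate field k⟮y/(t − η)⟯ generated by k and y/(t − η), and Gal(F'/k⟮y/(t − η)⟯) is isomorphic to the dihedral group of order q+1. -/

import Mathlib

open IntermediateField Polynomial

/-- The bivariate polynomial `b X^m Y^m + (X^(2m) - 1)` is irreducible, by Eisenstein's criterion
at `X - 1`. -/
theorem irreducible_C_mul_X_pow_add_C {k : Type*} [Field k] {m : ℕ} (hm : 0 < m)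
    (hm2 : ((2 * m : ℕ) : k) ≠ 0) {b : k} (hb : b ≠ 0) :
    Irreducible (C (C b * X ^ m) * X ^ m + C (X ^ (2 * m) - 1) : k[X][X]) := by
  have hbX : (C b * X ^ m : k[X]) ≠ 0 := by simp [hb]
  have hprime : (Ideal.span {(X - C 1 : k[X])}).IsPrime :=
    (Ideal.span_singleton_prime (X_sub_C_ne_zero 1)).2 (prime_X_sub_C 1)
  generalize hf : (C (C b * X ^ m) * X ^ m + C (X ^ (2 * m) - 1) : k[X][X]) = f
  have hdeg : f.natDegree = m := by
    rw [← hf, natDegree_add_C, natDegree_C_mul_X_pow _ _ hbX]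
  have hcm : f.coeff m = C b * X ^ m := by
    rw [← hf, coeff_add, coeff_C_mul_X_pow, coeff_C, if_pos rfl, if_neg hm.ne', add_zero]
  have hc0 : f.coeff 0 = X ^ (2 * m) - 1 := by
    rw [← hf, coeff_add, coeff_C_mul_X_pow, coeff_C, if_pos rfl, if_neg hm.ne, zero_add]
  refine irreducible_of_eisenstein_criterion hprime ?_ ?_ ?_ ?_ ?_
  · rw [leadingCoeff, hdeg, hcm, Ideal.mem_span_singleton, dvd_iff_isRoot]
    simp [hb]
  · intro n hn
    rw [coe_lt_degree, hdeg] at hn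
    rw [← hf, coeff_add, coeff_C_mul_X_pow, coeff_C, if_neg hn.ne, zero_add]
    split_ifs
    · rw [Ideal.mem_span_singleton, dvd_iff_isRoot]
      simp
    · exact zero_mem _
  · rw [← natDegree_pos_iff_degree_pos, hdeg]; exact hm
  · rw [hc0, Ideal.span_singleton_pow, Ideal.mem_span_singleton]
    intro h
    have hsep : (X ^ (2 * m) - C 1 : k[X]).Separable :=
      separable_X_pow_sub_C 1 hm2 one_ne_zero
    exact not_isUnit_X_sub_C _ (hsep.squarefree (X - C 1) (by simpa [sq] using h))
  · intro r hr
    rw [C_dvd_iff_dvd_coeff] at hr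
    have h1 := hr m
    have h0 := hr 0
    rw [hcm] at h1
    rw [hc0] at h0
    have hco : IsCoprime (C b * X ^ m : k[X]) (X ^ (2 * m) - 1) := by
      refine ⟨C b⁻¹ * X ^ m, -1, ?_⟩
      have : (C b⁻¹ * C b : k[X]) = 1 := by rw [← C_mul, inv_mul_cancel₀ hb, C_1]
      linear_combination (X ^ (2 * m)) * this
    exact hco.isUnit_of_dvd' h1 h0

theorem degree_C_mul_X_pow_add_one_lt {R : Type*} [Semiring R] {m : ℕ} (hm : 0 < m) (a : R) :
    (C a * X ^ m + 1 : R[X]).degree < (2 * m : ℕ) :=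
  lt_of_le_of_lt (b := (m : WithBot ℕ)) (by compute_degree!) (by exact_mod_cast (by omega))

open scoped algebraAdjoinAdjoin in
/-- If `u` is transcendental over `k`, then `X^(2m) - b u^m X^m - 1` is irreducible
over `k(u)`. -/
theorem irreducible_X_pow_two_mul_sub_sub_one {k F : Type*} [Field k] [Field F] [Algebra k F]
    {m : ℕ} (hm : 0 < m) (hm2 : ((2 * m : ℕ) : k) ≠ 0) {b : k} (hb : b ≠ 0) {u : F}
    (hu : Transcendental k u) :
    Irreducible (X ^ (2 * m) - C (algebraMap k k⟮u⟯ b * AdjoinSimple.gen k u ^ m) * X ^ m - 1 :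
      k⟮u⟯[X]) := by
  have : UniqueFactorizationMonoid (Algebra.adjoin k {u}) := hu.uniqueFactorizationMonoid_adjoin
  let e := Polynomial.algEquivOfTranscendental k u hu
  have h := irreducible_C_mul_X_pow_add_C hm hm2 (neg_ne_zero.2 hb)
  rw [← MulEquiv.irreducible_iff (Bivariate.swap (R := k)),
    ← MulEquiv.irreducible_iff (mapEquiv e.toRingEquiv)] at h
  have hmap : mapEquiv e.toRingEquiv (Bivariate.swap
        (C (C (-b) * X ^ m) * X ^ m + C (X ^ (2 * m) - 1) : k[X][X])) =
      X ^ (2 * m) - (C (algebraMap k (Algebra.adjoin k {u}) b *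
        ⟨u, Algebra.self_mem_adjoin_singleton k u⟩ ^ m) * X ^ m + 1) := by
    simp [e, Bivariate.swap_C, Bivariate.swap_Y, -SubmonoidClass.mk_pow]
    ring
  rw [hmap] at h
  rw [(monic_X_pow_sub (degree_C_mul_X_pow_add_one_lt hm _)).irreducible_iff_irreducible_map_fraction_map (K := k⟮u⟯)] at h
  convert h using 1
  simp [sub_sub, -SubmonoidClass.mk_pow]
  exact .inl rfl

/-- The homomorphism from a dihedral group given by the images of its rotations and of a
reflection. -/
def DihedralGroup.lift {n : ℕ} {G : Type*} [Group G] (φ : Multiplicative (ZMod n) →* G) (s : G)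
    (hs : s * s = 1) (hφ : ∀ i, s * φ i * s = (φ i)⁻¹) : DihedralGroup n →* G where
  toFun
    | .r i => φ (.ofAdd i)
    | .sr i => s * φ (.ofAdd i)
  map_one' := φ.map_one
  map_mul' := by
    have hinv : s⁻¹ = s := inv_eq_of_mul_eq_one_left hs
    have hcomm : ∀ i, φ i * s = s * (φ i)⁻¹ := fun i ↦ by
      rw [← hφ, ← mul_assoc, ← mul_assoc, hs, one_mul]
    rintro (i | i) (j | j)
    · simp [ofAdd_add]
    · simp only [DihedralGroup.r_mul_sr]
      rw [← mul_assoc, hcomm, sub_eq_neg_add, ofAdd_add, ofAdd_neg, map_mul, map_inv, mul_assoc]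
    · simp [ofAdd_add, mul_assoc]
    · simp only [DihedralGroup.sr_mul_sr]
      rw [mul_assoc, ← mul_assoc _ s, hcomm, ← mul_assoc, ← mul_assoc, hs, one_mul,
        sub_eq_neg_add, ofAdd_add, ofAdd_neg, map_mul, map_inv]

/-- Let `z` be transcendental over `k` and let `b u^m = z^m - z^(-m)` with `b ∈ k` nonzero and
`2m` invertible in `k`. Then `k(u, z)` is Galois over `k(u)` with dihedral group of order `2m`,
generated by `z ↦ ζ z` and `z ↦ ξ / z`, where `ζ` is a primitive `m`-th root of unity and
`ξ^m = -1`. -/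
theorem isGalois_and_nonempty_mulEquiv_dihedralGroup {k F : Type*} [Field k] [IsAlgClosed k]
    [Field F] [Algebra k F] {m : ℕ} (hm : 0 < m) (hm2 : ((2 * m : ℕ) : k) ≠ 0) {b : k}
    (hb : b ≠ 0) {u z : F} (hz : Transcendental k z) (hgen : adjoin k {u, z} = ⊤)
    (huz : algebraMap k F b * u ^ m = z ^ m - (z ^ m)⁻¹) :
    FiniteDimensional k⟮u⟯ F ∧ IsGalois k⟮u⟯ F ∧
      Nonempty ((F ≃ₐ[k⟮u⟯] F) ≃* DihedralGroup m) := by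
  have hz0 : z ≠ 0 := fun h ↦ hz (h ▸ isAlgebraic_zero)
  have hmk : (m : k) ≠ 0 := fun h ↦ hm2 (by simp [h])
  have : NeZero (m : k) := ⟨hmk⟩
  have : NeZero m := ⟨hm.ne'⟩
  set f : k⟮u⟯[X] :=
    X ^ (2 * m) - C (algebraMap k k⟮u⟯ b * AdjoinSimple.gen k u ^ m) * X ^ m - 1 with hf
  have hlt := degree_C_mul_X_pow_add_one_lt hm (algebraMap k k⟮u⟯ b * AdjoinSimple.gen k u ^ m)
  have hmonic : f.Monic := by
    rw [hf, sub_sub]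
    exact monic_X_pow_sub hlt
  have hdeg : f.natDegree = 2 * m := by
    refine natDegree_eq_of_degree_eq_some ?_
    rw [hf, sub_sub, degree_sub_eq_left_of_degree_lt (by rwa [degree_X_pow]), degree_X_pow]
  have hf0 : f ≠ 0 := hmonic.ne_zero
  have hroot (x : F) (hx0 : x ≠ 0) (hx : x ^ m - (x ^ m)⁻¹ = z ^ m - (z ^ m)⁻¹) :
      aeval x f = 0 := by
    rw [← huz] at hx
    have hxm : x ^ m ≠ 0 := pow_ne_zero _ hx0
    have : aeval x f = x ^ (2 * m) - algebraMap k F b * u ^ m * x ^ m - 1 := by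
      simp [hf]
    rw [this, ← hx]
    field_simp
    ring
  have hzroot : aeval z f = 0 := hroot z hz0 rfl
  have hzint : IsIntegral k⟮u⟯ z := IsAlgebraic.isIntegral ⟨f, hf0, hzroot⟩
  have hu : Transcendental k u := fun h ↦ by
    have := isAlgebraic_adjoin_simple h.isIntegral
    exact hz (hzint.isAlgebraic.restrictScalars k)
  have hirr : Irreducible f := irreducible_X_pow_two_mul_sub_sub_one hm hm2 hb hu
  have htop : k⟮u⟯⟮z⟯ = ⊤ := by
    rw [← restrictScalars_eq_top_iff (K := k), adjoin_simple_adjoin_simple, hgen]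
  have hfin : FiniteDimensional k⟮u⟯ F := by
    have := adjoin.finiteDimensional hzint
    rw [htop] at this
    exact topEquiv.toLinearEquiv.finiteDimensional
  have hmin : minpoly k⟮u⟯ z = f :=
    (minpoly.eq_of_irreducible_of_monic hirr hzroot hmonic).symm
  have hrank : Module.finrank k⟮u⟯ F = 2 * m := by
    rw [← finrank_top', ← htop, adjoin.finrank hzint, hmin, hdeg]
  have hmF : (m : F) ≠ 0 := by
    rw [← map_natCast (algebraMap k F)]
    exact (_root_.map_ne_zero _).2 hmk
  obtain ⟨ζ, hζ⟩ := HasEnoughRootsOfUnity.exists_primitiveRoot k m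
  obtain ⟨ξ, hξ⟩ := IsAlgClosed.exists_pow_nat_eq (-1 : k) hm
  have hξ0 : ξ ≠ 0 := by
    rintro rfl
    simp [hm.ne'] at hξ
  have hζF := hζ.map_of_injective (algebraMap k F).injective
  have hξF : algebraMap k F ξ ^ m = -1 := by rw [← map_pow, hξ, map_neg, map_one]
  have hξF0 : algebraMap k F ξ ≠ 0 := (_root_.map_ne_zero _).2 hξ0
  have hfactor : f.map (algebraMap k⟮u⟯ F) = (X ^ m - C (z ^ m)) * (X ^ m - C (-(z ^ m)⁻¹)) := by
    have : f.map (algebraMap k⟮u⟯ F) =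
        X ^ (2 * m) - C (algebraMap k F b * u ^ m) * X ^ m - 1 := by
      simp [hf]
    have h1 : C (z ^ m) * C (z ^ m)⁻¹ = 1 := by
      rw [← C_mul, mul_inv_cancel₀ (pow_ne_zero _ hz0), C_1]
    rw [this, huz, C_sub, C_neg]
    linear_combination h1
  have hsplit : (f.map (algebraMap k⟮u⟯ F)).Splits := by
    rw [hfactor]
    refine (X_pow_sub_C_splits_of_isPrimitiveRoot hζF rfl).mul
      (X_pow_sub_C_splits_of_isPrimitiveRoot hζF (α := algebraMap k F ξ * z⁻¹) ?_)
    rw [mul_pow, hξF, inv_pow, neg_one_mul]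
  have hsep : f.Separable := by
    rw [← separable_map (algebraMap k⟮u⟯ F), hfactor]
    have hne : z ^ m + (z ^ m)⁻¹ ≠ 0 := fun h ↦ by
      have : z ^ (2 * m) = algebraMap k F (-1) := by
        have := pow_ne_zero m hz0
        field_simp at h
        rw [map_neg, map_one]
        linear_combination h
      exact hz (IsAlgebraic.of_pow (n := 2 * m) (by omega) (this ▸ isAlgebraic_algebraMap _))
    refine (separable_X_pow_sub_C _ hmF (pow_ne_zero _ hz0)).mul
      (separable_X_pow_sub_C _ hmF (neg_ne_zero.2 (inv_ne_zero (pow_ne_zero _ hz0)))) ?_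
    refine ⟨-C (z ^ m + (z ^ m)⁻¹)⁻¹, C (z ^ m + (z ^ m)⁻¹)⁻¹, ?_⟩
    have h1 : C (z ^ m + (z ^ m)⁻¹)⁻¹ * (C (z ^ m) + C (z ^ m)⁻¹) = 1 := by
      rw [← C_add, ← C_mul, inv_mul_cancel₀ hne, C_1]
    rw [C_neg]
    linear_combination h1
  have hsf : IsSplittingField k⟮u⟯ F f := by
    rw [isSplittingField_iff_intermediateField]
    refine ⟨hsplit, top_le_iff.1 (htop ▸ adjoin.mono _ _ _ ?_)⟩
    rw [Set.singleton_subset_iff, mem_rootSet]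
    exact ⟨hf0, hzroot⟩
  have hgal : IsGalois k⟮u⟯ F := .of_separable_splitting_field hsep
  have hext (σ τ : F ≃ₐ[k⟮u⟯] F) (h : σ z = τ z) : σ = τ := by
    have htop' : Algebra.adjoin k⟮u⟯ {z} = ⊤ := by
      rw [← adjoin_simple_toSubalgebra_of_isAlgebraic hzint.isAlgebraic, htop, top_toSubalgebra]
    exact AlgEquiv.coe_toAlgHom_injective
      (AlgHom.ext_of_adjoin_eq_top htop' (Set.eqOn_singleton.2 h))
  have hconj (x : F) (hx0 : x ≠ 0) (hx : x ^ m - (x ^ m)⁻¹ = z ^ m - (z ^ m)⁻¹) :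
      ∃ σ : F ≃ₐ[k⟮u⟯] F, σ z = x :=
    minpoly.exists_algEquiv_of_root' hzint.isAlgebraic (by rw [hmin]; exact hroot x hx0 hx)
  have hfix (σ : F ≃ₐ[k⟮u⟯] F) (c : k) : σ (algebraMap k F c) = algebraMap k F c :=
    (σ.restrictScalars k).commutes c
  obtain ⟨ρ, hρ⟩ := hconj (algebraMap k F ζ * z)
    (mul_ne_zero (hζF.ne_zero hm.ne') hz0) (by rw [mul_pow, hζF.pow_eq_one, one_mul])
  obtain ⟨σ, hσ⟩ := hconj (algebraMap k F ξ * z⁻¹) (mul_ne_zero hξF0 (inv_ne_zero hz0)) (by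
    rw [mul_pow, hξF, inv_pow, neg_one_mul, inv_neg, inv_inv]
    ring)
  have hρpow (i : ℕ) : (ρ ^ i) z = algebraMap k F ζ ^ i * z := by
    induction i with
    | zero => simp
    | succ i ih => rw [pow_succ', AlgEquiv.mul_apply, ih, map_mul, map_pow, hfix, hρ]; ring
  have hρm : ρ ^ m = 1 := hext _ _ (by rw [hρpow, hζF.pow_eq_one, one_mul]; rfl)
  have hσσ : σ * σ = 1 := hext _ _ (by
    rw [AlgEquiv.mul_apply, hσ, map_mul, map_inv₀, hfix, hσ]
    simp
    field_simp)
  have hσρ (i : ℕ) : σ * ρ ^ i * σ * ρ ^ i = 1 := hext _ _ (by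
    have := pow_ne_zero i (hζF.ne_zero hm.ne')
    simp only [AlgEquiv.mul_apply, hρpow, map_mul, map_pow, map_inv₀, hfix, hσ]
    simp
    field_simp)
  let φ : Multiplicative (ZMod m) →* (F ≃ₐ[k⟮u⟯] F) :=
    { toFun := fun i ↦ ρ ^ i.toAdd.val
      map_one' := by simp
      map_mul' := fun i j ↦ by rw [toAdd_mul, ZMod.val_add, ← pow_eq_pow_mod _ hρm, pow_add] }
  have hφ (i : Multiplicative (ZMod m)) : φ i = ρ ^ i.toAdd.val := rfl
  let Φ := DihedralGroup.lift φ σ hσσ fun i ↦ by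
    rw [hφ, eq_inv_iff_mul_eq_one, hσρ]
  have hΦ : Function.Injective Φ := by
    rw [injective_iff_map_eq_one]
    rintro (i | i) h
    · have h1 : ρ ^ i.val = 1 := (hφ _).symm.trans h
      have h2 : algebraMap k F ζ ^ i.val = 1 := by
        have := hρpow i.val
        rw [h1, AlgEquiv.one_apply] at this
        exact mul_right_cancel₀ hz0 (by rw [← this, one_mul])
      have h3 := Nat.eq_zero_of_dvd_of_lt (hζF.dvd_of_pow_eq_one _ h2) (ZMod.val_lt i)
      rw [(ZMod.val_eq_zero i).1 h3]
      rfl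
    · have h1 : σ * ρ ^ i.val = 1 := by rw [← h, ← toAdd_ofAdd i, ← hφ]; rfl
      have h2 : z ^ 2 = algebraMap k F (ζ ^ i.val * ξ) := by
        have := DFunLike.congr_fun h1 z
        rw [AlgEquiv.mul_apply, hρpow, map_mul, map_pow, hfix, hσ, AlgEquiv.one_apply] at this
        field_simp at this
        rw [map_mul, map_pow, this]
      exact (hz (IsAlgebraic.of_pow two_pos (h2 ▸ isAlgebraic_algebraMap _))).elim
  refine ⟨hfin, hgal, ⟨(MulEquiv.ofBijective Φ ?_).symm⟩⟩
  rw [Nat.bijective_iff_injective_and_card]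
  exact ⟨hΦ, by rw [DihedralGroup.nat_card, IsGalois.card_aut_eq_finrank, hrank]⟩

/-- Let `F' = k(t, y)` be the function field of the curve
`y^(q+1) = t^q - 2 t^((q+1)/2) + t`, and let `η ∈ k` satisfy `η^q = η` and
`η^((q-1)/2) = -1`.  Then `F'` is a finite Galois extension of `k⟮y/(t - η)⟯`, and its
Galois group is isomorphic to the dihedral group of order `q + 1`. -/
theorem stmt_17
    (k : Type*) [Field k] [IsAlgClosed k]
    (p : ℕ) [Fact p.Prime] (hp2 : p ≠ 2) [CharP k p]
    (n q : ℕ) (hq : q = p ^ n) (hq5 : 5 ≤ q)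
    (F' : Type*) [Field F'] [Algebra k F']
    (t y : F') (ht : Transcendental k t)
    (hty : y ^ (q + 1) = t ^ q - 2 * t ^ ((q + 1) / 2) + t)
    (hgen : adjoin k {t, y} = ⊤)
    (η : k) (hη : η ^ q = η) (hη' : η ^ ((q - 1) / 2) = -1)
    (u : F') (hu : u = y / (t - algebraMap k F' η)) :
    FiniteDimensional k⟮u⟯ F' ∧ IsGalois k⟮u⟯ F' ∧
      Nonempty ((F' ≃ₐ[k⟮u⟯] F') ≃* DihedralGroup ((q + 1) / 2)) := by
  have hp : p.Prime := Fact.out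
  obtain ⟨r, hr⟩ : Odd q := hq ▸ (hp.odd_of_ne_two hp2).pow
  have hr2 : 2 ≤ r := by omega
  have hm : (q + 1) / 2 = r + 1 := by omega
  have hr1 : (q - 1) / 2 = r := by omega
  rw [hm] at hty ⊢
  rw [hr1] at hη'
  have hn : n ≠ 0 := by
    rintro rfl
    rw [pow_zero] at hq
    omega
  have hqk : (q : k) = 0 := by simp [hq, hn]
  have h2k : (2 : k) ≠ 0 := Ring.two_ne_zero (by rwa [ringChar.eq k p])
  have hm2 : ((2 * (r + 1) : ℕ) : k) ≠ 0 := by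
    rw [show 2 * (r + 1) = q + 1 by omega, Nat.cast_add, hqk]
    simp
  have h2F : (2 : F') ≠ 0 := by
    rw [← map_ofNat (algebraMap k F')]
    exact (_root_.map_ne_zero _).2 h2k
  have : CharP F' p := charP_of_injective_algebraMap (algebraMap k F').injective p
  have hnalg (d : ℕ) (hd : 0 < d) (c : k) : t ^ d ≠ algebraMap k F' c := fun h ↦
    ht (IsAlgebraic.of_pow hd (h ▸ isAlgebraic_algebraMap c))
  have htη : t - algebraMap k F' η ≠ 0 :=
    sub_ne_zero.2 (by simpa using hnalg 1 one_pos η)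
  have htr : t ^ r - 1 ≠ 0 :=
    sub_ne_zero.2 (by simpa using hnalg r (by omega) 1)
  obtain ⟨ε', hε'⟩ := IsAlgClosed.exists_pow_nat_eq η two_pos
  have hη0 : η ≠ 0 := by
    rintro rfl
    rw [zero_pow (by omega)] at hη'
    exact one_ne_zero (neg_eq_zero.1 hη'.symm)
  have hε'0 : ε' ≠ 0 := by
    rintro rfl
    exact hη0 (by simpa using hε'.symm)
  generalize hε : algebraMap k F' ε' = ε
  have hε0 : ε ≠ 0 := hε ▸ (_root_.map_ne_zero _).2 hε'0
  have hεη : algebraMap k F' η = ε ^ 2 := by rw [← hε', map_pow, hε]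
  have hεq : ε ^ q = -ε := by
    rw [hr, pow_succ, pow_mul, ← hεη, ← map_pow, hη', map_neg, map_one, neg_one_mul]
  set s : F' := y ^ (r + 1) / (t ^ r - 1) with hs
  have hst : s ^ 2 = t := by
    rw [hs, div_pow, div_eq_iff (pow_ne_zero _ htr), ← pow_mul,
      show (r + 1) * 2 = q + 1 by omega, hty, hr]
    ring
  have hsy : s ^ q - s = y ^ (r + 1) := by
    rw [hr, pow_succ, pow_mul, hst, ← sub_one_mul, hs, mul_div_cancel₀ _ htr]
  have hsε : t - algebraMap k F' η = (s - ε) * (s + ε) := by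
    rw [← hst, hεη]
    ring
  rw [hsε] at htη hu
  have h1 : s - ε ≠ 0 := left_ne_zero_of_mul htη
  have h2 : s + ε ≠ 0 := right_ne_zero_of_mul htη
  obtain ⟨z, hz⟩ : ∃ z, z = (s - ε) / (s + ε) := ⟨_, rfl⟩
  have hz1 : 1 - z ≠ 0 := by
    rw [hz, one_sub_div h2, show s + ε - (s - ε) = 2 * ε by ring]
    exact div_ne_zero (mul_ne_zero h2F hε0) h2
  have hsz : s = ε * (1 + z) / (1 - z) := by
    rw [eq_div_iff hz1, hz]
    field_simp
    ring
  have hztrans : Transcendental k z := fun h ↦ ht (by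
    have h1 : IsAlgebraic k (1 : F') := isAlgebraic_one
    have h3 : IsAlgebraic k ε := hε ▸ isAlgebraic_algebraMap ε'
    rw [← hst, hsz, div_eq_mul_inv]
    exact ((h3.mul (h1.add h)).mul (h1.sub h).inv).pow 2)
  have hgen' : adjoin k {u, z} = ⊤ := by
    have hu' : u ∈ adjoin k {u, z} := subset_adjoin _ _ (by simp)
    have hz' : z ∈ adjoin k {u, z} := subset_adjoin _ _ (by simp)
    have hs' : s ∈ adjoin k {u, z} := by
      rw [hsz, ← hε]
      exact div_mem (mul_mem (_root_.algebraMap_mem _ _) (add_mem (one_mem _) hz'))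
        (sub_mem (one_mem _) hz')
    rw [eq_top_iff, ← hgen, adjoin_le_iff, Set.insert_subset_iff, Set.singleton_subset_iff]
    refine ⟨hst ▸ pow_mem hs' 2, ?_⟩
    rw [show y = u * ((s - ε) * (s + ε)) by rw [hu, div_mul_cancel₀ _ htη], ← hε]
    exact mul_mem hu' (mul_mem (sub_mem hs' (_root_.algebraMap_mem _ _))
      (add_mem hs' (_root_.algebraMap_mem _ _)))
  refine isGalois_and_nonempty_mulEquiv_dihedralGroup (Nat.succ_pos r) hm2
    (b := -2 * ε') (mul_ne_zero (neg_ne_zero.2 h2k) hε'0) hztrans hgen' ?_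
  have hp1 : (s - ε) ^ (2 * (r + 1)) = (s - ε) * (s ^ q + ε) := by
    rw [show 2 * (r + 1) = q + 1 by omega, pow_succ', hq, sub_pow_char_pow, ← hq, hεq,
      sub_neg_eq_add]
  have hp2 : (s + ε) ^ (2 * (r + 1)) = (s + ε) * (s ^ q - ε) := by
    rw [show 2 * (r + 1) = q + 1 by omega, pow_succ', hq, add_pow_char_pow, ← hq, hεq,
      sub_eq_add_neg]
  rw [hu, hz, map_mul, hε, map_neg, map_ofNat, div_pow, div_pow, inv_div, mul_pow,
    div_sub_div _ _ (pow_ne_zero _ h2) (pow_ne_zero _ h1), ← sq, ← sq, ← pow_mul, ← pow_mul,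
    mul_comm (r + 1) 2, hp1, hp2, mul_comm ((s + ε) ^ _), ← hsy, mul_div_assoc']
  congr 1
  ring
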